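/- Let q ∈ (1,2) and let Ω₁ ⊆ Ω₂ ⊆ ℝ^N be bounded open sets. For i = 1, 2, let w_i be a Lane–Emden density of Ω_i, i.e., a minimizer of J_{Ω_i}(φ) = (1/2)[φ]_s² − (1/q)∫_{Ω_i} φ^q dx among nonnegative φ ∈ 𝒦(Ω_i). Then w₁ ≤ w₂ a.e. in ℝ^N. -/

import Mathlib

open MeasureTheory Filter Topology
open scoped ENNReal RealInnerProductSpace

noncomputable section

abbrev Euc (N : ℕ) := EuclideanSpace ℝ (Fin N)

/-- Gagliardo energy `[u]_s²`. -/
def gagliardo (N : ℕ) (s : ℝ) (u : Euc N → ℝ) : ℝ≥0∞ :=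
  ∫⁻ x : Euc N, ∫⁻ y : Euc N, ENNReal.ofReal ((u x - u y) ^ 2 / ‖x - y‖ ^ ((N : ℝ) + 2 * s))

/-- membership in the concrete model of `𝒟^{s,2}_0(Ω)`. -/
def memK (N : ℕ) (s : ℝ) (Ω : Set (Euc N)) (u : Euc N → ℝ) : Prop :=
  Measurable u ∧ (∀ᵐ x : Euc N ∂volume, x ∉ Ω → u x = 0) ∧ gagliardo N s u < ⊤

/-- first `q`-semilinear `s`-eigenvalue. -/
def lambda1 (N : ℕ) (s q : ℝ) (Ω : Set (Euc N)) : ℝ≥0∞ :=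
  ⨅ u ∈ {u : Euc N → ℝ | memK N s Ω u ∧ (∫ x in Ω, |u x| ^ q) = 1}, gagliardo N s u

/-- nonlocal bilinear form. -/
def dform (N : ℕ) (s : ℝ) (u φ : Euc N → ℝ) : ℝ :=
  ∫ p : Euc N × Euc N, (u p.1 - u p.2) * (φ p.1 - φ p.2) / ‖p.1 - p.2‖ ^ ((N : ℝ) + 2 * s)

/-- compactness of the embedding `𝒦(Ω) ↪ L^q(Ω)`. -/
def compactEmbed (N : ℕ) (s q : ℝ) (Ω : Set (Euc N)) : Prop :=
  ∀ u : ℕ → Euc N → ℝ, (∀ n, memK N s Ω (u n)) →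
    (∃ C : ℝ≥0∞, C < ⊤ ∧ ∀ n, gagliardo N s (u n) ≤ C) →
    ∃ (σ : ℕ → ℕ) (v : Euc N → ℝ), StrictMono σ ∧
      Tendsto (fun k => ∫ x in Ω, |u (σ k) x - v x| ^ q) atTop (𝓝 0)

/-- `q`-semilinear `s`-eigenfunction with eigenvalue `lam`. -/
def isEigenfunction (N : ℕ) (s q : ℝ) (Ω : Set (Euc N)) (lam : ℝ) (u : Euc N → ℝ) : Prop :=
  memK N s Ω u ∧ 0 < ∫ x in Ω, |u x| ^ q ∧
  ∀ φ : Euc N → ℝ, memK N s Ω φ →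
    dform N s u φ
      = lam * (∫ x in Ω, |u x| ^ q) ^ ((2 - q) / q) * ∫ x in Ω, |u x| ^ (q - 2) * u x * φ x

/-- `q`-semilinear `s`-eigenvalue. -/
def isEigenvalue (N : ℕ) (s q : ℝ) (Ω : Set (Euc N)) (lam : ℝ) : Prop :=
  0 < lam ∧ ∃ u : Euc N → ℝ, isEigenfunction N s q Ω lam u

/-- free energy functional `J_Ω`. -/
def freeEnergy (N : ℕ) (s q : ℝ) (Ω : Set (Euc N)) (φ : Euc N → ℝ) : ℝ :=
  (1 / 2) * (gagliardo N s φ).toReal - (1 / q) * ∫ x in Ω, φ x ^ q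

/-- Lane–Emden density of `Ω`: minimizer of the free energy among nonnegative members of `𝒦(Ω)`. -/
def isLaneEmden (N : ℕ) (s q : ℝ) (Ω : Set (Euc N)) (w : Euc N → ℝ) : Prop :=
  memK N s Ω w ∧ (∀ᵐ x : Euc N ∂volume, 0 ≤ w x) ∧
  ∀ φ : Euc N → ℝ, memK N s Ω φ → (∀ᵐ x : Euc N ∂volume, 0 ≤ φ x) →
    freeEnergy N s q Ω w ≤ freeEnergy N s q Ω φ

/-- weak solution of the fractional Lane–Emden equation in `Ω`. -/
def isWeakSolutionLE (N : ℕ) (s q : ℝ) (Ω : Set (Euc N)) (u : Euc N → ℝ) : Prop :=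
  memK N s Ω u ∧ ∀ φ : Euc N → ℝ, memK N s Ω φ →
    dform N s u φ = ∫ x in Ω, |u x| ^ (q - 2) * u x * φ x

/-- nonlocal tail. -/
def nlTail (N : ℕ) (s : ℝ) (w : Euc N → ℝ) (x₀ : Euc N) (ρ : ℝ) : ℝ :=
  ρ ^ (2 * s) * ∫ x in (Metric.ball x₀ ρ)ᶜ, |w x| / ‖x - x₀‖ ^ ((N : ℝ) + 2 * s)

/-- The integrand of the Gagliardo energy, on the product space. -/
def gagliardoDensity (N : ℕ) (s : ℝ) (u : Euc N → ℝ) (p : Euc N × Euc N) : ℝ≥0∞ :=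
  ENNReal.ofReal ((u p.1 - u p.2) ^ 2 / ‖p.1 - p.2‖ ^ ((N : ℝ) + 2 * s))

lemma measurable_gagliardoDensity {N : ℕ} (s : ℝ) {u : Euc N → ℝ} (hu : Measurable u) :
    Measurable (gagliardoDensity N s u) := by
  unfold gagliardoDensity
  fun_prop

lemma gagliardo_eq_lintegral_prod {N : ℕ} (s : ℝ) {u : Euc N → ℝ} (hu : Measurable u) :
    gagliardo N s u = ∫⁻ p, gagliardoDensity N s u p ∂(volume.prod volume) := by
  rw [lintegral_prod _ (measurable_gagliardoDensity s hu).aemeasurable]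
  rfl

/-- The mean of order `q` of the absolute values of two reals. -/
def powerMean (q a c : ℝ) : ℝ := ((|a| ^ q + |c| ^ q) / 2) ^ (1 / q)

lemma powerMean_nonneg (q a c : ℝ) : 0 ≤ powerMean q a c := by
  unfold powerMean; positivity

lemma powerMean_rpow {q : ℝ} (hq : 0 < q) (a c : ℝ) :
    powerMean q a c ^ q = (|a| ^ q + |c| ^ q) / 2 := by
  unfold powerMean
  rw [← Real.rpow_mul (by positivity), one_div_mul_cancel hq.ne', Real.rpow_one]

lemma powerMean_zero {q : ℝ} (hq : 0 < q) : powerMean q 0 0 = 0 := by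
  simp [powerMean, Real.zero_rpow hq.ne', Real.zero_rpow (inv_ne_zero hq.ne')]

lemma powerMean_le_add {q : ℝ} (hq : 1 ≤ q) (a b c d : ℝ) :
    powerMean q a c ≤ powerMean q b d + powerMean q (a - b) (c - d) := by
  have h := Real.Lp_add_le (Finset.univ : Finset (Fin 2)) ![b, d] ![a - b, c - d] hq
  simp only [Fin.sum_univ_two, Matrix.cons_val_zero, Matrix.cons_val_one,
    add_sub_cancel] at h
  unfold powerMean
  rw [Real.div_rpow (by positivity) (by positivity), Real.div_rpow (by positivity) (by positivity),
    Real.div_rpow (by positivity) (by positivity), ← add_div]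
  gcongr

lemma powerMean_sq_le {q : ℝ} (hq : q ∈ Set.Ioo (1 : ℝ) 2) (a c : ℝ) :
    powerMean q a c ^ 2 ≤ (a ^ 2 + c ^ 2) / 2 := by
  obtain ⟨hq1, hq2⟩ := hq
  have hq0 : 0 < q := by linarith
  have hcx := convexOn_rpow (p := 2 / q) (by rw [le_div_iff₀ hq0]; linarith)
  have h := hcx.2 (Set.mem_Ici.2 (show 0 ≤ |a| ^ q by positivity))
    (Set.mem_Ici.2 (show 0 ≤ |c| ^ q by positivity))
    one_half_pos.le one_half_pos.le (add_halves 1)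
  have e (t : ℝ) : (|t| ^ q) ^ (2 / q) = t ^ 2 := by
    rw [← Real.rpow_mul (abs_nonneg _), mul_div_cancel₀ _ hq0.ne', Real.rpow_two, sq_abs]
  simp only [smul_eq_mul, e] at h
  have e2 : powerMean q a c ^ 2 = (1 / 2 * |a| ^ q + 1 / 2 * |c| ^ q) ^ (2 / q) := by
    unfold powerMean
    rw [← Real.rpow_two, ← Real.rpow_mul (by positivity)]
    congr 1 <;> ring
  linarith

lemma eq_of_powerMean_sq_eq {q : ℝ} (hq : q ∈ Set.Ioo (1 : ℝ) 2) {a c : ℝ}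
    (ha : 0 ≤ a) (hc : 0 ≤ c) (hac : powerMean q a c ^ 2 = (a ^ 2 + c ^ 2) / 2) : a = c := by
  obtain ⟨hq1, hq2⟩ := hq
  have hq0 : 0 < q := by linarith
  by_contra hne
  have hcx := strictConvexOn_rpow (p := 2 / q) (by rw [lt_div_iff₀ hq0]; linarith)
  have h := hcx.2 (Set.mem_Ici.2 (show 0 ≤ a ^ q by positivity))
    (Set.mem_Ici.2 (show 0 ≤ c ^ q by positivity))
    (fun h => hne ((Real.rpow_left_inj ha hc hq0.ne').1 h))
    one_half_pos one_half_pos (add_halves 1)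
  have e (t : ℝ) (ht : 0 ≤ t) : (t ^ q) ^ (2 / q) = t ^ 2 := by
    rw [← Real.rpow_mul ht, mul_div_cancel₀ _ hq0.ne', Real.rpow_two]
  simp only [smul_eq_mul, e a ha, e c hc] at h
  have e2 : powerMean q a c ^ 2 = (1 / 2 * a ^ q + 1 / 2 * c ^ q) ^ (2 / q) := by
    unfold powerMean
    rw [← Real.rpow_two, ← Real.rpow_mul (by positivity), abs_of_nonneg ha, abs_of_nonneg hc]
    congr 1 <;> ring
  linarith

lemma powerMean_sub_sq_le {q : ℝ} (hq : q ∈ Set.Ioo (1 : ℝ) 2) (a b c d : ℝ) :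
    (powerMean q a c - powerMean q b d) ^ 2 ≤ ((a - b) ^ 2 + (c - d) ^ 2) / 2 := by
  refine le_trans ?_ (powerMean_sq_le hq (a - b) (c - d))
  have h₁ := powerMean_le_add hq.1.le a b c d
  have h₂ := powerMean_le_add hq.1.le b a d c
  have e : powerMean q (b - a) (d - c) = powerMean q (a - b) (c - d) := by
    simp only [powerMean, abs_sub_comm b a, abs_sub_comm d c]
  exact sq_le_sq' (by linarith) (by linarith)

lemma min_sub_sq_add_max_sub_sq_le (a b c d : ℝ) :
    (min a c - min b d) ^ 2 + (max a c - max b d) ^ 2 ≤ (a - b) ^ 2 + (c - d) ^ 2 := by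
  rcases le_total a c with h | h <;> rcases le_total b d with h' | h' <;>
    simp only [min_eq_left, min_eq_right, max_eq_left, max_eq_right, h, h'] <;>
    nlinarith [mul_nonneg (sub_nonneg.2 h) (sub_nonneg.2 h')]

lemma gagliardoDensity_powerMean_le {N : ℕ} (s : ℝ) {q : ℝ} (hq : q ∈ Set.Ioo (1 : ℝ) 2)
    (u v : Euc N → ℝ) (p : Euc N × Euc N) :
    gagliardoDensity N s (fun x => powerMean q (u x) (v x)) p
      ≤ 2⁻¹ * (gagliardoDensity N s u p + gagliardoDensity N s v p) := by
  unfold gagliardoDensity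
  rw [← ENNReal.ofReal_add (by positivity) (by positivity), ← add_div,
    show (2⁻¹ : ℝ≥0∞) = ENNReal.ofReal 2⁻¹ by
      rw [ENNReal.ofReal_inv_of_pos two_pos, ENNReal.ofReal_ofNat],
    ← ENNReal.ofReal_mul (by positivity), ← mul_div_assoc]
  gcongr
  linarith [powerMean_sub_sq_le hq (u p.1) (u p.2) (v p.1) (v p.2)]

lemma gagliardo_min_add_max_le {N : ℕ} (s : ℝ) {u v : Euc N → ℝ}
    (hu : Measurable u) (hv : Measurable v) :
    gagliardo N s (fun x => min (u x) (v x)) + gagliardo N s (fun x => max (u x) (v x))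
      ≤ gagliardo N s u + gagliardo N s v := by
  rw [gagliardo_eq_lintegral_prod s hu, gagliardo_eq_lintegral_prod s hv,
    gagliardo_eq_lintegral_prod s (hu.min hv), gagliardo_eq_lintegral_prod s (hu.max hv),
    ← lintegral_add_left (measurable_gagliardoDensity s hu),
    ← lintegral_add_left (measurable_gagliardoDensity s (hu.min hv))]
  refine lintegral_mono fun p => ?_
  unfold gagliardoDensity
  rw [← ENNReal.ofReal_add (by positivity) (by positivity), ← add_div,
    ← ENNReal.ofReal_add (by positivity) (by positivity), ← add_div]
  exact ENNReal.ofReal_le_ofReal (div_le_div_of_nonneg_right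
    (min_sub_sq_add_max_sub_sq_le _ _ _ _) (by positivity))

lemma volume_compl_ne_zero_of_isBounded {N : ℕ} (hN : 1 ≤ N) {Ω : Set (Euc N)}
    (hb : Bornology.IsBounded Ω) : volume Ωᶜ ≠ 0 := by
  have : Nonempty (Fin N) := ⟨⟨0, hN⟩⟩
  have : Nontrivial (Euc N) := inferInstance
  intro h
  have h₁ : volume (Set.univ : Set (Euc N)) ≤ volume Ω + volume Ωᶜ := by
    rw [← Set.union_compl_self Ω]; exact measure_union_le _ _
  rw [h, add_zero, measure_univ_of_isAddLeftInvariant] at h₁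
  exact absurd (hb.measure_lt_top (μ := volume)) (not_lt.2 h₁)

lemma memK.integrable_rpow {N : ℕ} (hN : 1 ≤ N) {s q : ℝ} (hs : 0 < s)
    (hq : q ∈ Set.Ioo (1 : ℝ) 2) {Ω : Set (Euc N)} (ho : IsOpen Ω) (hb : Bornology.IsBounded Ω)
    {u : Euc N → ℝ} (hu : memK N s Ω u) (hu₀ : ∀ᵐ x : Euc N ∂volume, 0 ≤ u x) :
    Integrable (fun x => u x ^ q) := by
  obtain ⟨hm, hz, hfin⟩ := hu
  have hmeas := measurable_gagliardoDensity s hm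
  have hlt : ∀ᵐ x : Euc N, ∫⁻ y, gagliardoDensity N s u (x, y) < ⊤ :=
    ae_lt_top hmeas.lintegral_prod_right' hfin.ne
  obtain ⟨x, hxΩ, hx, hux⟩ := ((frequently_ae_mem_iff.2
    (volume_compl_ne_zero_of_isBounded hN hb)).and_eventually (hlt.and hz)).exists
  specialize hux hxΩ
  obtain ⟨C, hC⟩ := hb.subset_closedBall x
  set p : ℝ := (N : ℝ) + 2 * s with hp
  have hp0 : 0 < p := by positivity
  have hint : Integrable (fun y => (u x - u y) ^ 2 / ‖x - y‖ ^ p) := by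
    refine ⟨Measurable.aestronglyMeasurable (by fun_prop), ?_⟩
    rw [hasFiniteIntegral_iff_ofReal (ae_of_all _ fun y => by positivity)]
    exact hx
  have hone : Integrable (Ω.indicator fun _ => (1 : ℝ)) :=
    (integrable_indicator_iff ho.measurableSet).2 (integrableOn_const hb.measure_lt_top.ne)
  refine (hone.add (hint.const_mul (C ^ p))).mono'
    (Measurable.aestronglyMeasurable (by fun_prop)) ?_
  filter_upwards [hz, hu₀] with y hy hy₀
  rw [Real.norm_of_nonneg (Real.rpow_nonneg hy₀ _)]
  by_cases hyΩ : y ∈ Ω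
  · have hpos : 0 < ‖x - y‖ := norm_pos_iff.2 (sub_ne_zero.2 fun h => hxΩ (h ▸ hyΩ))
    have hle : ‖x - y‖ ≤ C := by
      have := hC hyΩ
      rwa [Metric.mem_closedBall, dist_comm, dist_eq_norm] at this
    have h₁ : u y ^ q ≤ 1 + u y ^ 2 := by
      rcases le_total (u y) 1 with h | h
      · have := Real.rpow_le_one hy₀ h (by linarith [hq.1] : (0 : ℝ) ≤ q)
        nlinarith
      · have := Real.rpow_le_rpow_of_exponent_le h hq.2.le
        rw [Real.rpow_two] at this
        linarith
    have h₂ : u y ^ 2 ≤ C ^ p * ((u x - u y) ^ 2 / ‖x - y‖ ^ p) := by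
      rw [hux, zero_sub, neg_sq, mul_div_assoc', le_div_iff₀ (by positivity), mul_comm]
      gcongr
    simp only [Pi.add_apply, Set.indicator_of_mem hyΩ]
    linarith
  · rw [hy hyΩ, Real.zero_rpow (by linarith [hq.1])]
    simp only [Pi.add_apply, Set.indicator_of_notMem hyΩ, hux, hy hyΩ]
    simp

lemma memK.freeEnergy_eq {N : ℕ} {s q : ℝ} (hq : 0 < q) {Ω : Set (Euc N)}
    {u : Euc N → ℝ} (hu : memK N s Ω u) :
    freeEnergy N s q Ω u = (1 / 2) * (gagliardo N s u).toReal - (1 / q) * ∫ x, u x ^ q := by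
  unfold freeEnergy
  rw [setIntegral_eq_integral_of_ae_compl_eq_zero]
  filter_upwards [hu.2.1] with x hx hxΩ
  rw [hx hxΩ, Real.zero_rpow hq.ne']

/-- The free energy has at most one nonnegative minimizer. -/
lemma isLaneEmden.ae_eq {N : ℕ} (hN : 1 ≤ N) {s q : ℝ} (hs : 0 < s)
    (hq : q ∈ Set.Ioo (1 : ℝ) 2) {Ω : Set (Euc N)} (ho : IsOpen Ω) (hb : Bornology.IsBounded Ω)
    {u v : Euc N → ℝ} (hu : isLaneEmden N s q Ω u) (hv : isLaneEmden N s q Ω v) :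
    u =ᵐ[volume] v := by
  obtain ⟨huK, hu₀, hmin⟩ := hu
  obtain ⟨hvK, hv₀, hmin'⟩ := hv
  have hq0 : 0 < q := by linarith [hq.1]
  have hmu := measurable_gagliardoDensity s huK.1
  have hmv := measurable_gagliardoDensity s hvK.1
  set σ : Euc N → ℝ := fun x => powerMean q (u x) (v x) with hσ
  have hσm : Measurable σ := by
    have := huK.1
    have := hvK.1
    simp only [hσ, powerMean]
    fun_prop
  have hmean : ∫⁻ p, 2⁻¹ * (gagliardoDensity N s u p + gagliardoDensity N s v p)
      ∂(volume.prod volume) = 2⁻¹ * (gagliardo N s u + gagliardo N s v) := by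
    rw [lintegral_const_mul' _ _ (by simp), lintegral_add_left hmu,
      gagliardo_eq_lintegral_prod s huK.1, gagliardo_eq_lintegral_prod s hvK.1]
  have hmean_fin : 2⁻¹ * (gagliardo N s u + gagliardo N s v) < ⊤ :=
    ENNReal.mul_lt_top (by simp) (ENNReal.add_lt_top.2 ⟨huK.2.2, hvK.2.2⟩)
  have hle : gagliardo N s σ ≤ 2⁻¹ * (gagliardo N s u + gagliardo N s v) := by
    rw [← hmean, gagliardo_eq_lintegral_prod s hσm]
    exact lintegral_mono fun p => gagliardoDensity_powerMean_le s hq u v p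
  have hσK : memK N s Ω σ := by
    refine ⟨hσm, ?_, hle.trans_lt hmean_fin⟩
    filter_upwards [huK.2.1, hvK.2.1] with x hxu hxv hx
    simp only [hσ, hxu hx, hxv hx, powerMean_zero hq0]
  have hσ₀ : ∀ᵐ x : Euc N ∂volume, 0 ≤ σ x := ae_of_all _ fun x => powerMean_nonneg _ _ _
  have hint : ∫ x, σ x ^ q = ((∫ x, u x ^ q) + ∫ x, v x ^ q) / 2 := by
    rw [← integral_add (huK.integrable_rpow hN hs hq ho hb hu₀)
      (hvK.integrable_rpow hN hs hq ho hb hv₀), ← integral_div]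
    refine integral_congr_ae ?_
    filter_upwards [hu₀, hv₀] with x hxu hxv
    simp only [hσ]
    rw [powerMean_rpow hq0, abs_of_nonneg hxu, abs_of_nonneg hxv]
  have h₁ := hmin σ hσK hσ₀
  have h₂ := hmin' σ hσK hσ₀
  rw [hσK.freeEnergy_eq hq0, hint] at h₁ h₂
  rw [huK.freeEnergy_eq hq0] at h₁
  rw [hvK.freeEnergy_eq hq0] at h₂
  have hge : 2⁻¹ * (gagliardo N s u + gagliardo N s v) ≤ gagliardo N s σ := by
    rw [← ENNReal.toReal_le_toReal hmean_fin.ne hσK.2.2.ne, ENNReal.toReal_mul,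
      ENNReal.toReal_add huK.2.2.ne hvK.2.2.ne, ENNReal.toReal_inv, ENNReal.toReal_ofNat]
    linarith
  have hae : gagliardoDensity N s σ =ᵐ[volume.prod volume]
      fun p => 2⁻¹ * (gagliardoDensity N s u p + gagliardoDensity N s v p) := by
    refine ae_eq_of_ae_le_of_lintegral_le
      (ae_of_all _ fun p => gagliardoDensity_powerMean_le s hq u v p) ?_
      ((hmu.add hmv).const_mul _).aemeasurable ?_
    · rw [← gagliardo_eq_lintegral_prod s hσm]
      exact hσK.2.2.ne
    · rw [hmean, ← gagliardo_eq_lintegral_prod s hσm]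
      exact hge
  filter_upwards [Measure.ae_ae_of_ae_prod hae, huK.2.1, hvK.2.1, hu₀, hv₀]
    with x hx hxu hxv hxu₀ hxv₀
  by_cases hxΩ : x ∈ Ω
  · obtain ⟨y, hyΩ, hy, hyu, hyv⟩ := ((frequently_ae_mem_iff.2
      (volume_compl_ne_zero_of_isBounded hN hb)).and_eventually
      (hx.and (huK.2.1.and hvK.2.1))).exists
    have hpos : 0 < ‖x - y‖ := norm_pos_iff.2 (sub_ne_zero.2 fun h => hyΩ (h ▸ hxΩ))
    refine eq_of_powerMean_sq_eq hq hxu₀ hxv₀ ?_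
    simp only [gagliardoDensity, hσ, hyu hyΩ, hyv hyΩ, powerMean_zero hq0, sub_zero] at hy
    rw [← ENNReal.ofReal_add (by positivity) (by positivity), ← add_div,
      show (2⁻¹ : ℝ≥0∞) = ENNReal.ofReal 2⁻¹ by
        rw [ENNReal.ofReal_inv_of_pos two_pos, ENNReal.ofReal_ofNat],
      ← ENNReal.ofReal_mul (by positivity), ← mul_div_assoc,
      ENNReal.ofReal_eq_ofReal_iff (by positivity) (by positivity),
      div_left_inj' (by positivity)] at hy
    linarith
  · rw [hxu hxΩ, hxv hxΩ]

/-- comparison of Lane–Emden densities of nested bounded open sets. -/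
theorem stmt_7 (N : ℕ) (hN : 1 ≤ N) (s : ℝ) (hs : s ∈ Set.Ioo (0 : ℝ) 1)
    (q : ℝ) (hq : q ∈ Set.Ioo (1 : ℝ) 2)
    (Ω₁ Ω₂ : Set (Euc N)) (h1o : IsOpen Ω₁) (h2o : IsOpen Ω₂)
    (h1b : Bornology.IsBounded Ω₁) (h2b : Bornology.IsBounded Ω₂) (hsub : Ω₁ ⊆ Ω₂)
    (w₁ w₂ : Euc N → ℝ)
    (hw1 : isLaneEmden N s q Ω₁ w₁) (hw2 : isLaneEmden N s q Ω₂ w₂) :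
    ∀ᵐ x : Euc N ∂volume, w₁ x ≤ w₂ x := by
  have hs0 := hs.1
  have hq0 : 0 < q := by linarith [hq.1]
  obtain ⟨hK₁, hw₁, hmin₁⟩ := hw1
  obtain ⟨hK₂, hw₂, hmin₂⟩ := hw2
  have hG := gagliardo_min_add_max_le s hK₁.1 hK₂.1
  have hGfin := ENNReal.add_lt_top.1
    (hG.trans_lt (ENNReal.add_lt_top.2 ⟨hK₁.2.2, hK₂.2.2⟩))
  have hKm : memK N s Ω₁ (fun x => min (w₁ x) (w₂ x)) := by
    refine ⟨hK₁.1.min hK₂.1, ?_, hGfin.1⟩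
    filter_upwards [hK₁.2.1, hw₂] with x hx hx₂ hxΩ
    rw [hx hxΩ, min_eq_left hx₂]
  have hKM : memK N s Ω₂ (fun x => max (w₁ x) (w₂ x)) := by
    refine ⟨hK₁.1.max hK₂.1, ?_, hGfin.2⟩
    filter_upwards [hK₁.2.1, hK₂.2.1] with x hx hx₂ hxΩ
    rw [hx fun h => hxΩ (hsub h), hx₂ hxΩ, max_self]
  have hm₀ : ∀ᵐ x : Euc N ∂volume, 0 ≤ min (w₁ x) (w₂ x) := by
    filter_upwards [hw₁, hw₂] with x h h' using le_min h h'
  have hM₀ : ∀ᵐ x : Euc N ∂volume, 0 ≤ max (w₁ x) (w₂ x) := by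
    filter_upwards [hw₁] with x h using le_max_of_le_left h
  have hint : (∫ x, min (w₁ x) (w₂ x) ^ q) + ∫ x, max (w₁ x) (w₂ x) ^ q
      = (∫ x, w₁ x ^ q) + ∫ x, w₂ x ^ q := by
    rw [← integral_add (hKm.integrable_rpow hN hs0 hq h1o h1b hm₀)
        (hKM.integrable_rpow hN hs0 hq h2o h2b hM₀),
      ← integral_add (hK₁.integrable_rpow hN hs0 hq h1o h1b hw₁)
        (hK₂.integrable_rpow hN hs0 hq h2o h2b hw₂)]
    congr 1
    ext x
    rcases le_total (w₁ x) (w₂ x) with h | h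
    · rw [min_eq_left h, max_eq_right h]
    · rw [min_eq_right h, max_eq_left h, add_comm]
  have hG' := ENNReal.toReal_mono (ENNReal.add_lt_top.2 ⟨hK₁.2.2, hK₂.2.2⟩).ne hG
  rw [ENNReal.toReal_add hGfin.1.ne hGfin.2.ne,
    ENNReal.toReal_add hK₁.2.2.ne hK₂.2.2.ne] at hG'
  have hJ : freeEnergy N s q Ω₁ (fun x => min (w₁ x) (w₂ x)) ≤ freeEnergy N s q Ω₁ w₁ := by
    have h := hmin₂ _ hKM hM₀
    rw [hK₂.freeEnergy_eq hq0, hKM.freeEnergy_eq hq0] at h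
    rw [hK₁.freeEnergy_eq hq0, hKm.freeEnergy_eq hq0]
    have hint' := congrArg (fun t => (1 / q) * t) hint
    simp only [mul_add] at hint'
    linarith
  have hLE : isLaneEmden N s q Ω₁ (fun x => min (w₁ x) (w₂ x)) :=
    ⟨hKm, hm₀, fun φ hφ hφ₀ => hJ.trans (hmin₁ φ hφ hφ₀)⟩
  filter_upwards [isLaneEmden.ae_eq hN hs0 hq h1o h1b ⟨hK₁, hw₁, hmin₁⟩ hLE] with x hx
  rw [hx]
  exact min_le_right _ _
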